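/- For ε₂ = 0, the derivative of M₂ in virtue of the equations of motion satisfies {H,M₂} = [−2M₃ − 2λ − 2ε₁(β₁−α₂) + 2ε₁β₁]M₁ − 2ε₁α₁M₂ at every point of ℝ⁹, for all real values of λ and ε₁. -/

import Mathlib

noncomputable section

/-- The phase space `ℝ⁹` with coordinates `(M₁,M₂,M₃,α₁,α₂,α₃,β₁,β₂,β₃)`. -/
abbrev V9 : Type := Fin 9 → ℝ

/-- Index of `M_i` among the nine coordinates. -/
def mIdx (i : Fin 3) : Fin 9 := ⟨i.1, by have := i.isLt; omega⟩
/-- Index of `α_i` among the nine coordinates. -/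
def aIdx (i : Fin 3) : Fin 9 := ⟨i.1 + 3, by have := i.isLt; omega⟩
/-- Index of `β_i` among the nine coordinates. -/
def bIdx (i : Fin 3) : Fin 9 := ⟨i.1 + 6, by have := i.isLt; omega⟩

/-- The Levi-Civita symbol `ε_{ijk} = ½(i−j)(j−k)(k−i)`. -/
def epsSym (i j k : Fin 3) : ℝ :=
  (((i.1 : ℝ) - (j.1 : ℝ)) * ((j.1 : ℝ) - (k.1 : ℝ)) * ((k.1 : ℝ) - (i.1 : ℝ))) / 2

/-- Partial derivative of `f : ℝ⁹ → ℝ` in the `i`-th coordinate direction. -/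
def pd (i : Fin 9) (f : V9 → ℝ) (x : V9) : ℝ := fderiv ℝ f x (Pi.single i 1)

/-- The Lie–Poisson bracket of the Lie coalgebra `e(3,2)*`. -/
def pb (f g : V9 → ℝ) (x : V9) : ℝ :=
  ∑ i : Fin 3, ∑ j : Fin 3, ∑ k : Fin 3, epsSym i j k *
    (pd (mIdx i) f x * pd (mIdx j) g x * x (mIdx k)
      + (pd (mIdx i) f x * pd (aIdx j) g x - pd (mIdx i) g x * pd (aIdx j) f x) * x (aIdx k)
      + (pd (mIdx i) f x * pd (bIdx j) g x - pd (mIdx i) g x * pd (bIdx j) f x) * x (bIdx k))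

/-- The Hamiltonian `H` of the generalized two-field gyrostat. -/
def Hfun (lam e1 e2 : ℝ) : V9 → ℝ := fun x =>
  x 0 ^ 2 + x 1 ^ 2 + 2 * x 2 ^ 2 + 2 * lam * x 2 - 2 * e2 * (x 3 + x 7)
    + 2 * e1 * (x 1 * x 5 - x 2 * x 4 + x 2 * x 6 - x 0 * x 8)

theorem pd_eq_of_hasDerivAt {f : V9 → ℝ} {x : V9} {i : Fin 9} {c : ℝ}
    (hf : DifferentiableAt ℝ f x)
    (h : HasDerivAt (fun t : ℝ => f (x + t • Pi.single i 1)) c 0) : pd i f x = c :=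
  (hf.hasFDerivAt.hasLineDerivAt _).unique h

theorem differentiable_Hfun (lam e1 e2 : ℝ) : Differentiable ℝ (Hfun lam e1 e2) := by
  unfold Hfun
  fun_prop

theorem pd_coord (i j : Fin 9) (x : V9) :
    pd i (fun y => y j) x = (Pi.single i 1 : V9) j := by
  simp [pd, fderiv_apply]

/-- The partial derivatives of `H`, given as the differential of `H` on the `i`-th unit vector. -/
theorem pd_Hfun (lam e1 e2 : ℝ) (i : Fin 9) (x : V9) :
    pd i (Hfun lam e1 e2) x =
      (fun v : V9 => 2 * x 0 * v 0 + 2 * x 1 * v 1 + 4 * x 2 * v 2 + 2 * lam * v 2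
        - 2 * e2 * (v 3 + v 7)
        + 2 * e1 * (v 1 * x 5 + x 1 * v 5 - (v 2 * x 4 + x 2 * v 4)
          + (v 2 * x 6 + x 2 * v 6) - (v 0 * x 8 + x 0 * v 8))) (Pi.single i 1) := by
  refine pd_eq_of_hasDerivAt (differentiable_Hfun lam e1 e2 x) ?_
  generalize (Pi.single i 1 : V9) = v
  have h (j : Fin 9) : HasDerivAt (fun t : ℝ => (x + t • v) j) (v j) 0 := by
    simpa using ((hasDerivAt_id (0 : ℝ)).mul_const (v j)).const_add (x j)
  unfold Hfun
  refine HasDerivAt.congr_deriv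
    (((((((h 0).pow 2).add ((h 1).pow 2)).add (((h 2).pow 2).const_mul 2)).add
    ((h 2).const_mul (2 * lam))).sub (((h 3).add (h 7)).const_mul (2 * e2))).add
    ((((((h 1).mul (h 5)).sub ((h 2).mul (h 4))).add ((h 2).mul (h 6))).sub
      ((h 0).mul (h 8))).const_mul (2 * e1))) ?_
  simp
  ring

/-- For `ε₂ = 0`, `{H, M₂} = [−2M₃ − 2λ − 2ε₁(β₁−α₂) + 2ε₁β₁]M₁ − 2ε₁α₁M₂` everywhere. -/
theorem bracket_H_M2 (lam e1 : ℝ) (x : V9) :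
    pb (Hfun lam e1 0) (fun y => y 1) x
      = (-(2 * x 2) - 2 * lam - 2 * e1 * (x 6 - x 4) + 2 * e1 * x 6) * x 0
        - 2 * e1 * x 3 * x 1 := by
  simp only [pb, pd_coord, pd_Hfun, Fin.sum_univ_three, epsSym, mIdx, aIdx, bIdx]
  simp [Fin.ext_iff]
  ring
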